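/- For every c ≤ 1, lim_{t→+∞} (t·f_c'(t) − f_c(t)) = λ_c. Moreover, lim_{t→−∞} (t·f_1'(t) − f_1(t)) = 0. -/

import Mathlib

open Real Filter

/-- A global spacelike solution: a `C²` function `f : ℝ → ℝ` with `|f'| < 1` and
`f'' = f^(n-1) (1 - f'^2)^((n+2)/2)` on all of `ℝ`. -/
def IsGSS (n : ℕ) (f : ℝ → ℝ) : Prop :=
  ContDiff ℝ 2 f ∧
  ∀ t : ℝ, |deriv f t| < 1 ∧
    deriv (deriv f) t = f t ^ (n - 1) * (1 - (deriv f t) ^ 2) ^ ((n + 2 : ℝ) / 2)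

/-- `IsFc n c f` says that `f` is the normalized global spacelike solution `f_c`:
for `c < 1` it satisfies `f 0 = (1-c)^(1/n)`, `f' 0 = 0` (so its first integral is `c`);
for `c = 1` it satisfies `f 0 = 1`, `f' 0 = √(1 - 2^(-2/n))` (first integral `1`,
and `f` is strictly increasing). -/
def IsFc (n : ℕ) (c : ℝ) (f : ℝ → ℝ) : Prop :=
  IsGSS n f ∧
  (c < 1 → f 0 = (1 - c) ^ ((1 : ℝ) / n) ∧ deriv f 0 = 0) ∧
  (c = 1 → f 0 = 1 ∧ deriv f 0 = Real.sqrt (1 - (2 : ℝ) ^ (-(2 : ℝ) / n)))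

/-- If `g` has a limit at `+∞` and its derivative is eventually antitone, then `t g'(t) → 0`. -/
theorem tendsto_mul_deriv_zero_of_antitoneOn {g g' : ℝ → ℝ} {T l : ℝ}
    (hg : ∀ t, HasDerivAt g (g' t) t) (hanti : AntitoneOn g' (Set.Ici T))
    (hlim : Tendsto g atTop (nhds l)) :
    Tendsto (fun t => t * g' t) atTop (nhds 0) := by
  have hmvt : ∀ a b : ℝ, a < b → ∃ s ∈ Set.Ioo a b, g b - g a = g' s * (b - a) := by
    intro a b hab
    obtain ⟨s, hs, h⟩ := exists_hasDerivAt_eq_slope g g' hab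
      (fun x _ => (hg x).continuousAt.continuousWithinAt) (fun x _ => hg x)
    exact ⟨s, hs, by rw [h, div_mul_cancel₀ _ (sub_ne_zero.2 hab.ne')]⟩
  have hdouble : Tendsto (fun t => g (2 * t) - g t) atTop (nhds 0) := by
    simpa using (hlim.comp (tendsto_id.const_mul_atTop (two_pos (α := ℝ)))).sub hlim
  have hhalf : Tendsto (fun t => 2 * (g t - g (t / 2))) atTop (nhds 0) := by
    simpa using
      (hlim.sub (hlim.comp (tendsto_id.atTop_div_const (two_pos (α := ℝ))))).const_mul 2
  refine tendsto_of_tendsto_of_tendsto_of_le_of_le' hdouble hhalf ?_ ?_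
  · filter_upwards [eventually_gt_atTop 0, eventually_ge_atTop T] with t ht hT
    obtain ⟨s, hs, h⟩ := hmvt t (2 * t) (by linarith)
    have : g' s ≤ g' t := hanti hT (hT.trans hs.1.le) hs.1.le
    rw [h]
    nlinarith
  · filter_upwards [eventually_gt_atTop 0, eventually_ge_atTop (2 * T)] with t ht hT
    obtain ⟨s, hs, h⟩ := hmvt (t / 2) t (by linarith)
    have hTs : T ≤ s := by linarith [hs.1]
    have : g' t ≤ g' s := hanti hTs (hTs.trans hs.2.le) hs.2.le
    rw [h]
    nlinarith

namespace IsGSS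

variable {n : ℕ} {f : ℝ → ℝ}

theorem hasDerivAt (hf : IsGSS n f) (t : ℝ) : HasDerivAt f (deriv f t) t :=
  (hf.1.differentiable (by norm_num) t).hasDerivAt

theorem hasDerivAt_deriv (hf : IsGSS n f) (t : ℝ) :
    HasDerivAt (deriv f) (deriv (deriv f) t) t :=
  (hf.1.differentiable_deriv_two t).hasDerivAt

theorem one_sub_sq_pos (hf : IsGSS n f) (t : ℝ) : 0 < 1 - deriv f t ^ 2 :=
  sub_pos.2 ((sq_lt_one_iff_abs_lt_one _).2 (hf.2 t).1)

/-- The derivative of a solution is monotone where the solution is nonnegative. -/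
theorem monotoneOn_deriv (hf : IsGSS n f) {s : Set ℝ} (hs : Convex ℝ s)
    (hpos : ∀ t ∈ s, 0 ≤ f t) : MonotoneOn (deriv f) s := by
  refine monotoneOn_of_deriv_nonneg hs
    (fun t _ => (hf.hasDerivAt_deriv t).continuousAt.continuousWithinAt)
    (fun t _ => (hf.hasDerivAt_deriv t).differentiableAt.differentiableWithinAt) fun t ht => ?_
  rw [(hf.2 t).2]
  exact mul_nonneg (pow_nonneg (hpos t (interior_subset ht)) _)
    (rpow_nonneg (hf.one_sub_sq_pos t).le _)

/-- Conservation of the first integral. -/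
theorem firstIntegral_eq (hf : IsGSS n f) (s t : ℝ) :
    (1 - deriv f s ^ 2) ^ (-(n : ℝ) / 2) - f s ^ n =
      (1 - deriv f t ^ 2) ^ (-(n : ℝ) / 2) - f t ^ n := by
  have hd : ∀ x, HasDerivAt
      (fun u => (1 - deriv f u ^ 2) ^ (-(n : ℝ) / 2) - f u ^ n) 0 x := by
    intro x
    have hpos := hf.one_sub_sq_pos x
    have h := (((hf.hasDerivAt_deriv x).fun_pow 2).const_sub 1).rpow_const
      (p := -(n : ℝ) / 2) (Or.inl hpos.ne')
    refine (h.sub ((hf.hasDerivAt x).fun_pow n)).congr_deriv ?_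
    have hmul : (1 - deriv f x ^ 2) ^ ((n + 2 : ℝ) / 2) *
        (1 - deriv f x ^ 2) ^ (-(n : ℝ) / 2 - 1) = 1 := by
      rw [← rpow_add hpos, show (n + 2 : ℝ) / 2 + (-(n : ℝ) / 2 - 1) = 0 by ring, rpow_zero]
    rw [(hf.2 x).2]
    push_cast
    linear_combination (n : ℝ) * deriv f x * f x ^ (n - 1) * hmul
  exact is_const_of_deriv_eq_zero (fun x => (hd x).differentiableAt) (fun x => (hd x).deriv) s t

/-- A solution with first integral `1` satisfies `f' ^ 2 ≤ f ^ 2`. -/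
theorem deriv_sq_le_sq (hf : IsGSS n f) (hn : 2 ≤ n)
    (hE : ∀ t, (1 - deriv f t ^ 2) ^ (-(n : ℝ) / 2) = 1 + f t ^ n) (t : ℝ) :
    deriv f t ^ 2 ≤ f t ^ 2 := by
  have hpos := hf.one_sub_sq_pos t
  rcases le_total 1 (|f t|) with h1 | h1
  · have : 1 ≤ f t ^ 2 := (one_le_sq_iff_one_le_abs _).2 h1
    linarith
  have hn' : (1 : ℝ) ≤ (n : ℝ) / 2 := by
    have : (2 : ℝ) ≤ n := by exact_mod_cast hn
    linarith
  have hpow : f t ^ n ≤ f t ^ 2 := calc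
    f t ^ n ≤ |f t| ^ n := by rw [← abs_pow]; exact le_abs_self _
    _ ≤ |f t| ^ 2 := pow_le_pow_of_le_one (abs_nonneg _) h1 hn
    _ = f t ^ 2 := sq_abs _
  have hinv : (1 - deriv f t ^ 2)⁻¹ ≤ 1 + f t ^ n := by
    rw [← hE t, ← rpow_neg_one]
    exact rpow_le_rpow_of_exponent_ge hpos (by linarith [sq_nonneg (deriv f t)]) (by linarith)
  have hmul : 1 ≤ (1 + f t ^ n) * (1 - deriv f t ^ 2) := by
    rwa [inv_le_iff_one_le_mul₀ hpos] at hinv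
  nlinarith [sq_nonneg (deriv f t), sq_nonneg (f t), mul_le_mul_of_nonneg_right hpow hpos.le]

/-- A solution with first integral `1` that is nonzero at `0` vanishes nowhere on `(-∞, 0]`. -/
theorem ne_zero_of_nonpos (hf : IsGSS n f) (hn : 2 ≤ n)
    (hE : ∀ t, (1 - deriv f t ^ 2) ^ (-(n : ℝ) / 2) = 1 + f t ^ n) (h0 : f 0 ≠ 0) {t : ℝ}
    (ht : t ≤ 0) : f t ≠ 0 := by
  have hd : ∀ x, HasDerivAt (fun u => f u ^ 2 * Real.exp (-2 * u))
      (2 * (f x * deriv f x - f x ^ 2) * Real.exp (-2 * x)) x := by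
    intro x
    have he : HasDerivAt (fun u : ℝ => Real.exp (-2 * u)) (Real.exp (-2 * x) * (-2 * 1)) x :=
      ((hasDerivAt_id x).const_mul (-2)).exp
    refine (((hf.hasDerivAt x).fun_pow 2).mul he).congr_deriv ?_
    push_cast
    ring
  have hanti : Antitone (fun u => f u ^ 2 * Real.exp (-2 * u)) := by
    refine antitone_of_hasDerivAt_nonpos hd fun x => ?_
    refine mul_nonpos_of_nonpos_of_nonneg ?_ (Real.exp_pos _).le
    nlinarith [hf.deriv_sq_le_sq hn hE x, sq_nonneg (f x - deriv f x)]
  intro h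
  have hle : f 0 ^ 2 * Real.exp (-2 * 0) ≤ f t ^ 2 * Real.exp (-2 * t) := hanti ht
  rw [h] at hle
  norm_num at hle
  exact h0 hle

end IsGSS

/-- A continuous function without zeros on `(-∞, 0]` that is positive at `0` is positive there. -/
theorem pos_of_continuous_of_ne_zero {g : ℝ → ℝ} (hg : Continuous g) (h0 : 0 < g 0)
    (hne : ∀ t ≤ 0, g t ≠ 0) {t : ℝ} (ht : t ≤ 0) : 0 < g t := by
  by_contra! h
  obtain ⟨s, hs, hs0⟩ := intermediate_value_Icc ht hg.continuousOn ⟨h, h0.le⟩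
  exact hne s hs.2 hs0

/-- The first integral of `f_1` is `1`. -/
theorem IsFc.firstIntegral_one {n : ℕ} {f : ℝ → ℝ} (hf : IsFc n 1 f) (hn : 2 ≤ n) (t : ℝ) :
    (1 - deriv f t ^ 2) ^ (-(n : ℝ) / 2) = 1 + f t ^ n := by
  obtain ⟨h0, h1⟩ := hf.2.2 rfl
  have hn0 : (n : ℝ) ≠ 0 := by positivity
  have hle : (2 : ℝ) ^ (-(2 : ℝ) / n) ≤ 1 :=
    rpow_le_one_of_one_le_of_nonpos one_le_two
      (div_nonpos_of_nonpos_of_nonneg (by norm_num) (Nat.cast_nonneg n))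
  have h := hf.1.firstIntegral_eq t 0
  rw [h0, h1, sq_sqrt (by linarith), sub_sub_cancel, ← rpow_mul zero_le_two,
    show -(2 : ℝ) / n * (-(n : ℝ) / 2) = 1 by field_simp, rpow_one, one_pow] at h
  linarith

/-- Behaviour of `f_1` at `-∞`. -/
theorem IsFc.tendsto_atBot {n : ℕ} {f : ℝ → ℝ} (hf : IsFc n 1 f) (hn : 2 ≤ n) :
    Tendsto (fun t => t * deriv f t - f t) atBot (nhds 0) := by
  obtain ⟨h0, h1⟩ := hf.2.2 rfl
  have hE := hf.firstIntegral_one hn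
  have hS := hf.1
  have hn0 : n ≠ 0 := by omega
  have hne : ∀ t ≤ 0, f t ≠ 0 := fun t ht => hS.ne_zero_of_nonpos hn hE (by simp [h0]) ht
  have hfpos : ∀ t ≤ 0, 0 < f t := fun t ht =>
    pos_of_continuous_of_ne_zero hS.1.continuous (by simp [h0]) hne ht
  have hdne : ∀ t ≤ 0, deriv f t ≠ 0 := by
    intro t ht h
    have := hE t
    rw [h] at this
    norm_num at this
    exact hne t ht this.1
  have hdcont : Continuous (deriv f) :=
    continuous_iff_continuousAt.2 fun t => (hS.hasDerivAt_deriv t).continuousAt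
  have hdpos : ∀ t ≤ 0, 0 < deriv f t := fun t ht =>
    pos_of_continuous_of_ne_zero hdcont
      ((h1 ▸ sqrt_nonneg _ : 0 ≤ deriv f 0).lt_of_ne' (hdne 0 le_rfl)) hdne ht
  have hmono : MonotoneOn f (Set.Iic 0) :=
    monotoneOn_of_deriv_nonneg (convex_Iic 0) hS.1.continuous.continuousOn
      (fun t _ => (hS.hasDerivAt t).differentiableAt.differentiableWithinAt)
      fun t ht => (hdpos t (Set.mem_Iic.1 (interior_subset ht))).le
  -- the reflected function `s ↦ -f (-s)` is eventually monotone and bounded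
  have hlim : ∃ l, Tendsto (fun s => -f (-s)) atTop (nhds l) := by
    have hm : Monotone (fun s : ℝ => -f (-max s 0)) := by
      intro a b hab
      have : max a 0 ≤ max b 0 := max_le_max_right 0 hab
      exact neg_le_neg (hmono (by simp) (by simp) (neg_le_neg this))
    have hb : BddAbove (Set.range fun s : ℝ => -f (-max s 0)) := by
      refine ⟨0, ?_⟩
      rintro _ ⟨s, rfl⟩
      exact neg_nonpos.2 (hfpos _ (by simp)).le
    refine ⟨_, (tendsto_atTop_ciSup hm hb).congr' ?_⟩
    filter_upwards [eventually_ge_atTop 0] with s hs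
    rw [max_eq_left hs]
  obtain ⟨l, hl⟩ := hlim
  have hg : ∀ s, HasDerivAt (fun s => -f (-s)) (deriv f (-s)) s := by
    intro s
    refine ((hS.hasDerivAt (-s)).comp s (hasDerivAt_neg s)).neg.congr_deriv ?_
    ring
  have hanti : AntitoneOn (fun s => deriv f (-s)) (Set.Ici 0) := fun a ha b hb hab =>
    hS.monotoneOn_deriv (convex_Iic 0) (fun t ht => (hfpos t ht).le)
      (Set.mem_Iic.2 (neg_nonpos.2 hb)) (Set.mem_Iic.2 (neg_nonpos.2 ha)) (neg_le_neg hab)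
  have hmul := tendsto_mul_deriv_zero_of_antitoneOn hg hanti hl
  have hderiv : Tendsto (fun s => deriv f (-s)) atTop (nhds 0) := by
    refine squeeze_zero' ?_ ?_ hmul
    · filter_upwards [eventually_ge_atTop 0] with s hs
      exact (hdpos _ (neg_nonpos.2 hs)).le
    · filter_upwards [eventually_ge_atTop 1] with s hs
      exact le_mul_of_one_le_left (hdpos _ (by linarith)).le hs
  have hpow : Tendsto (fun s => f (-s) ^ n) atTop (nhds 0) := by
    have h := ((hderiv.pow 2).const_sub 1).rpow_const (p := -(n : ℝ) / 2)
      (Or.inl (by norm_num))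
    simp only [hE] at h
    simpa using h.sub_const 1
  have hl0 : l = 0 := by
    have h := tendsto_nhds_unique (hl.neg.pow n) (by simpa using hpow)
    simpa using pow_eq_zero_iff hn0 |>.1 h
  subst hl0
  have h := (hmul.neg.add hl).comp tendsto_neg_atBot_atTop
  simp only [neg_zero, add_zero] at h
  refine h.congr fun t => ?_
  simp only [Function.comp_apply, neg_neg]
  ring

/-- If `√(1 + t²) - f t` converges, then `t f' - f` has the same limit at `+∞`. -/
theorem IsGSS.tendsto_atTop {n : ℕ} {f : ℝ → ℝ} (hf : IsGSS n f) {lam : ℝ}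
    (hlam : Tendsto (fun t => Real.sqrt (1 + t ^ 2) - f t) atTop (nhds lam)) :
    Tendsto (fun t => t * deriv f t - f t) atTop (nhds lam) := by
  have hsqrt : Tendsto (fun t : ℝ => Real.sqrt (1 + t ^ 2) - t) atTop (nhds 0) := by
    refine squeeze_zero' ?_ ?_ tendsto_inv_atTop_zero
    · exact Eventually.of_forall fun t => sub_nonneg.2 (le_sqrt_of_sq_le (by linarith))
    · filter_upwards [eventually_gt_atTop 0] with t ht
      rw [sub_le_iff_le_add, sqrt_le_left (by positivity)]
      have : t⁻¹ * t = 1 := inv_mul_cancel₀ ht.ne'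
      nlinarith [sq_nonneg t⁻¹]
  have hg : Tendsto (fun t => t - f t) atTop (nhds lam) := by
    simpa using hlam.sub hsqrt
  have hev : ∀ᶠ t in atTop, 0 ≤ f t := by
    filter_upwards [hg.eventually_lt_const (lt_add_one lam), eventually_ge_atTop (lam + 1)]
      with t h1 h2
    linarith
  obtain ⟨T, hT⟩ := eventually_atTop.1 hev
  have hanti : AntitoneOn (fun t => 1 - deriv f t) (Set.Ici T) := fun a ha b hb hab =>
    sub_le_sub_left (hf.monotoneOn_deriv (convex_Ici T) hT ha hb hab) 1
  have hmul := tendsto_mul_deriv_zero_of_antitoneOn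
    (fun t => (hasDerivAt_id' t).sub (hf.hasDerivAt t)) hanti hg
  have h := hg.sub hmul
  rw [sub_zero] at h
  exact h.congr fun t => by ring

/-- for every `c ≤ 1`, `t f_c'(t) - f_c(t) → λ_c` as `t → +∞`;
moreover for `c = 1`, `t f_1'(t) - f_1(t) → 0` as `t → -∞`. -/
theorem stmt_13 (n : ℕ) (hn : 2 ≤ n) (c : ℝ) (hc : c ≤ 1) (f : ℝ → ℝ)
    (hf : IsFc n c f) (lam : ℝ)
    (hlam : Tendsto (fun t => Real.sqrt (1 + t ^ 2) - f t) atTop (nhds lam)) :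
    Tendsto (fun t => t * deriv f t - f t) atTop (nhds lam) ∧
    (c = 1 → Tendsto (fun t => t * deriv f t - f t) atBot (nhds 0)) := by
  refine ⟨hf.1.tendsto_atTop hlam, ?_⟩
  rintro rfl
  exact hf.tendsto_atBot hn
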